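/- Under the hypotheses of the previous statement (Algorithm 1 with implicit multipliers, Assumption 1, (ε_k) nonincreasing, Σ α_kε_k < +∞ and β_kε_k → +∞), suppose in addition that there exists an integer K ≥ 1 such that either ‖x_k‖² + ‖y_k‖² ≥ ‖x̄*‖² + ‖ȳ*‖² for all k ≥ K, or ‖x_k‖² + ‖y_k‖² < ‖x̄*‖² + ‖ȳ*‖² for all k ≥ K. Then lim_{k→∞} ‖(x_k, y_k) − (x̄*, ȳ*)‖ = 0, i.e. (x_k, y_k) converges strongly to the minimal norm solution. -/

import Mathlib

open Filter Topology
open scoped RealInnerProductSpace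

/-- A convex continuous function on a Hilbert space whose values along `w` tend to its minimum `0`
forces strong convergence of `w` to the minimal norm minimizer `p`, as soon as the norms of `w`
are asymptotically at most `‖p‖`. -/
lemma tendsto_of_convex_of_norm_le {W : Type*} [NormedAddCommGroup W] [InnerProductSpace ℝ W]
    [CompleteSpace W] {V : W → ℝ} (hconv : ConvexOn ℝ Set.univ V) (hcont : Continuous V)
    {p : W} (hp : V p ≤ 0) (hmin : ∀ c, V c ≤ 0 → ‖p‖ ^ 2 ≤ ‖c‖ ^ 2)
    {w : ℕ → W} (hV : Tendsto (fun k => V (w k)) atTop (𝓝 0))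
    {t : ℕ → ℝ} (ht : Tendsto t atTop (𝓝 0)) (hw : ∀ᶠ k in atTop, ‖w k‖ ^ 2 ≤ ‖p‖ ^ 2 + t k) :
    Tendsto w atTop (𝓝 p) := by
  set S : ℕ → Set W := fun n => {c | V c ≤ 1 / ((n : ℝ) + 1)} with hS
  have hSconv : ∀ n, Convex ℝ (S n) := fun n => by
    have := hconv.convex_le (1 / ((n : ℝ) + 1))
    simpa [hS] using this
  have hScl : ∀ n, IsClosed (S n) := fun n => isClosed_le hcont continuous_const
  have hpS : ∀ n, p ∈ S n := fun n => hp.trans (by positivity)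
  have hanti : ∀ {n k}, n ≤ k → S k ⊆ S n := fun {n k} hnk c hc =>
    le_trans hc (one_div_le_one_div_of_le (show (0 : ℝ) < (n : ℝ) + 1 by positivity)
      (show (n : ℝ) + 1 ≤ (k : ℝ) + 1 by gcongr))
  have hex : ∀ n, ∃ m ∈ S n, ∀ c ∈ S n, ‖m‖ ≤ ‖c‖ := fun n => by
    obtain ⟨m, hm, h⟩ := exists_norm_eq_iInf_of_complete_convex ⟨p, hpS n⟩
      (hScl n).isComplete (hSconv n) 0
    refine ⟨m, hm, fun c hc => ?_⟩
    have hb : BddBelow (Set.range fun w : S n => ‖(0 : W) - w‖) :=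
      ⟨0, by rintro _ ⟨a, rfl⟩; positivity⟩
    simpa using h.trans_le (ciInf_le hb ⟨c, hc⟩)
  choose m hmS hm using hex
  have key : ∀ n, ∀ a ∈ S n, ∀ c ∈ S n, ‖a - c‖ ^ 2 ≤ 2 * ‖a‖ ^ 2 + 2 * ‖c‖ ^ 2 - 4 * ‖m n‖ ^ 2 := by
    intro n a ha c hc
    have h1 : (1 / 2 : ℝ) • a + (1 / 2 : ℝ) • c ∈ S n :=
      hSconv n ha hc (by norm_num) (by norm_num) (by norm_num)
    have h2 := hm n _ h1
    rw [← smul_add, norm_smul] at h2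
    have h3 := parallelogram_law_with_norm ℝ a c
    have h4 : ‖(1 / 2 : ℝ)‖ = 1 / 2 := by norm_num
    rw [h4] at h2
    nlinarith [norm_nonneg (m n), norm_nonneg (a + c)]
  have hmono : Monotone fun n => ‖m n‖ ^ 2 := fun n k hnk => by
    have := hm n _ (hanti hnk (hmS k))
    dsimp only
    gcongr
  have hbdd : ∀ n, ‖m n‖ ^ 2 ≤ ‖p‖ ^ 2 := fun n => by
    have := hm n _ (hpS n)
    gcongr
  have hlim := tendsto_atTop_ciSup hmono ⟨‖p‖ ^ 2, by rintro _ ⟨n, rfl⟩; exact hbdd n⟩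
  have hcau : CauchySeq m := by
    rw [Metric.cauchySeq_iff']
    intro e he
    obtain ⟨N, hN⟩ := Metric.cauchySeq_iff'.1 hlim.cauchySeq (e ^ 2 / 2) (by positivity)
    refine ⟨N, fun n hn => ?_⟩
    have h1 := (abs_lt.1 (by simpa [Real.dist_eq] using hN n hn)).2
    have h2 := key N _ (hanti hn (hmS n)) _ (hmS N)
    rw [dist_eq_norm]
    refine lt_of_pow_lt_pow_left₀ 2 he.le ?_
    linarith
  obtain ⟨c, hc⟩ := cauchySeq_tendsto_of_complete hcau
  have hVc : V c ≤ 0 :=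
    le_of_tendsto_of_tendsto' ((hcont.tendsto c).comp hc) tendsto_one_div_add_atTop_nhds_zero_nat
      hmS
  have hmp : Tendsto (fun n => ‖m n‖ ^ 2) atTop (𝓝 (‖p‖ ^ 2)) := by
    have h1 : Tendsto (fun n => ‖m n‖ ^ 2) atTop (𝓝 (‖c‖ ^ 2)) := hc.norm.pow 2
    have h2 : ‖c‖ ^ 2 ≤ ‖p‖ ^ 2 := le_of_tendsto' h1 hbdd
    rwa [le_antisymm h2 (hmin c hVc)] at h1
  rw [Metric.tendsto_atTop']
  intro e he
  obtain ⟨n, hn⟩ := (hmp.eventually (lt_mem_nhds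
    (show ‖p‖ ^ 2 - e ^ 2 / 8 < ‖p‖ ^ 2 by linarith [pow_pos he 2]))).exists
  have h1 : ∀ᶠ k in atTop, V (w k) < 1 / ((n : ℝ) + 1) :=
    hV.eventually (gt_mem_nhds (by positivity))
  have h2 : ∀ᶠ k in atTop, t k < e ^ 2 / 4 := ht.eventually (gt_mem_nhds (by positivity))
  obtain ⟨K, hK⟩ := eventually_atTop.1 (h1.and (h2.and hw))
  refine ⟨K, fun k hk => ?_⟩
  obtain ⟨a1, a2, a3⟩ := hK k hk.le
  have := key n (w k) a1.le p (hpS n)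
  rw [dist_eq_norm]
  refine lt_of_pow_lt_pow_left₀ 2 he.le ?_
  linarith

/-- A Kronecker type lemma: increments of size `β k * s k` with `s` summable are negligible
compared with `β`. -/
lemma tendsto_div_of_le_add_mul_summable {E β s : ℕ → ℝ} (hE : ∀ k, 1 ≤ k → 0 ≤ E k)
    (hβ : ∀ k, 1 ≤ k → 0 < β k) (hβmono : ∀ k, 1 ≤ k → β k ≤ β (k + 1))
    (hβtop : Tendsto β atTop atTop) (hs : ∀ k, 1 ≤ k → 0 ≤ s k) (hsum : Summable s)
    (hstep : ∀ k, 1 ≤ k → E (k + 1) ≤ E k + β k * s k) :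
    Tendsto (fun k => E k / β k) atTop (𝓝 0) := by
  set P : ℕ → ℝ := fun n => ∑ i ∈ Finset.range n, s i with hP
  have hPs : ∀ n, P (n + 1) = P n + s n := fun n => Finset.sum_range_succ _ _
  have main : ∀ m, 1 ≤ m → ∀ n, m ≤ n → P m ≤ P n ∧ E n ≤ E m + β n * (P n - P m) := by
    intro m hm n hn
    induction n, hn using Nat.le_induction with
    | base => simp
    | succ n hn ih =>
      have h1 : 1 ≤ n := hm.trans hn
      obtain ⟨ih1, ih2⟩ := ih
      have h2 : P m ≤ P (n + 1) := by rw [hPs]; linarith [hs n h1]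
      refine ⟨h2, ?_⟩
      have h3 : β n * (P (n + 1) - P m) ≤ β (n + 1) * (P (n + 1) - P m) :=
        mul_le_mul_of_nonneg_right (hβmono n h1) (by linarith)
      have h4 := hstep n h1
      rw [hPs] at h3 ⊢
      linarith
  have hcau : CauchySeq P := hsum.hasSum.tendsto_sum_nat.cauchySeq
  rw [Metric.tendsto_atTop']
  intro e he
  obtain ⟨N, hN⟩ := Metric.cauchySeq_iff.1 hcau (e / 2) (by positivity)
  set m := N + 1
  have hm1 : 1 ≤ m := by omega
  obtain ⟨K, hK⟩ := eventually_atTop.1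
    (((tendsto_const_nhds (x := E m)).div_atTop hβtop).eventually
      (gt_mem_nhds (show (0 : ℝ) < e / 2 by positivity)))
  refine ⟨max K m, fun n hn => ?_⟩
  have hnK : K ≤ n := (le_max_left _ _).trans hn.le
  have hnm : m ≤ n := (le_max_right _ _).trans hn.le
  have hb := hβ n (hm1.trans hnm)
  have h1 := (main m hm1 n hnm).2
  have h2 := hK n hnK
  have hd : P n - P m < e / 2 := (abs_lt.1 (hN n (by omega) m (by omega))).2
  rw [Real.dist_eq, sub_zero, abs_of_nonneg (div_nonneg (hE n (hm1.trans hnm)) hb.le)]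
  rw [div_lt_iff₀ hb] at h2 ⊢
  nlinarith

/-- One step of the energy estimate in a single block of variables. -/
lemma block_energy_step {X : Type*} [NormedAddCommGroup X] [InnerProductSpace ℝ X]
    {f : X → ℝ} {μ δ γ α β ε : ℝ} (hμ : 0 ≤ μ) (hδ : 0 < δ) (hδγ : 0 ≤ δ * γ - 1)
    (hα : 0 < α) (hβ : 0 < β) (hε : 0 ≤ ε) {x x' z z' d' u q p : X}
    (hu : ∀ w, f w - f x' - ⟪u, w - x'⟫ ≥ μ / 2 * ‖w - x'‖ ^ 2)
    (hz : z' = (1 / α) • (x' - x) + γ • x') (hd : d' = δ • z' + (1 - δ * γ) • x')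
    (hstep : (1 / α) • (z' - z) = -(β • (u + q + ε • x' - μ • (x' - d')))) :
    1 / 2 * ‖d' - p‖ ^ 2 + (δ * γ - 1) / 2 * ‖x' - p‖ ^ 2
      + δ * α * β * (f x' - f p) + δ ^ 2 * β * (f x' - f x) + δ * α * β * ⟪q, d' - p⟫
      + δ * α * β * ε / 2 * (‖x'‖ ^ 2 - ‖p‖ ^ 2) + δ ^ 2 * β * ε / 2 * (‖x'‖ ^ 2 - ‖x‖ ^ 2)
    ≤ 1 / 2 * ‖δ • z + (1 - δ * γ) • x - p‖ ^ 2 + (δ * γ - 1) / 2 * ‖x - p‖ ^ 2 := by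
  obtain ⟨s, rfl⟩ : ∃ s, x = x' - s := ⟨x' - x, by abel⟩
  obtain ⟨a, rfl⟩ : ∃ a, p = x' - a := ⟨x' - p, by abel⟩
  obtain ⟨c, hc⟩ : ∃ c, c = δ / α := ⟨_, rfl⟩
  have hc0 : 0 < c := hc ▸ div_pos hδ hα
  have hcα : δ = c * α := by rw [hc]; field_simp
  have hd' : d' = x' + c • s := by
    rw [hd, hz, hc, sub_sub_cancel, div_eq_mul_one_div]
    module
  have hzz : z' - z = -((α * β) • (u + q + ε • x' + (μ * c) • s)) := by
    have h1 : z' - z = α • ((1 / α) • (z' - z)) := by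
      rw [smul_smul, mul_one_div_cancel hα.ne', one_smul]
    rw [h1, hstep, hd']
    module
  have hold : δ • z + (1 - δ * γ) • (x' - s) - (x' - a)
      = (a + c • s) - (δ • (z' - z) + (1 - δ * γ) • s) := by
    have : δ • z' = d' - (1 - δ * γ) • x' := by rw [hd]; abel
    rw [smul_sub δ z' z, this, hd']
    module
  have hnew : d' - (x' - a) = a + c • s := by rw [hd']; abel
  have hi : ⟪δ • (z' - z) + (1 - δ * γ) • s, a + c • s⟫
      = -(δ * α * β) * (⟪u, a⟫ + c * ⟪u, s⟫ + ⟪q, a + c • s⟫ + ε * (⟪x', a⟫ + c * ⟪x', s⟫)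
        + μ * c * (⟪a, s⟫ + c * ‖s‖ ^ 2)) + (1 - δ * γ) * (⟪a, s⟫ + c * ‖s‖ ^ 2) := by
    rw [hzz]
    simp only [inner_add_left, inner_smul_left, inner_neg_left, inner_add_right, inner_smul_right,
      real_inner_self_eq_norm_sq, real_inner_comm s a, smul_neg, RCLike.conj_to_real]
    ring
  have hu1 := hu (x' - a)
  have hu2 := hu (x' - s)
  simp only [sub_sub_cancel_left, inner_neg_right, norm_neg] at hu1 hu2
  rw [hnew, hold, norm_sub_sq_real (a + c • s), real_inner_comm (δ • (z' - z) + _), hi]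
  have e1 : x' - (x' - a) = a := by abel
  have e2 : x' - s - (x' - a) = a - s := by abel
  rw [e1, e2, norm_sub_sq_real x' a, norm_sub_sq_real x' s, norm_sub_sq_real a s]
  have hsq : 0 ≤ ‖a‖ ^ 2 + 2 * c * ⟪a, s⟫ + c ^ 2 * ‖s‖ ^ 2 := by
    have : ‖a + c • s‖ ^ 2 = ‖a‖ ^ 2 + 2 * c * ⟪a, s⟫ + c ^ 2 * ‖s‖ ^ 2 := by
      rw [norm_add_sq_real, inner_smul_right, norm_smul, mul_pow, Real.norm_eq_abs, sq_abs]; ring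
    rw [← this]; positivity
  have g0 : 0 ≤ ‖δ • (z' - z) + (1 - δ * γ) • s‖ ^ 2 := by positivity
  have g1 : 0 ≤ δ * α * β * (f (x' - a) - f x' + ⟪u, a⟫ - μ / 2 * ‖a‖ ^ 2) :=
    mul_nonneg (by positivity) (by linarith)
  have g2 : 0 ≤ δ ^ 2 * β * (f (x' - s) - f x' + ⟪u, s⟫ - μ / 2 * ‖s‖ ^ 2) :=
    mul_nonneg (by positivity) (by linarith)
  have g3 : 0 ≤ δ * α * β * μ / 2 * (‖a‖ ^ 2 + 2 * c * ⟪a, s⟫ + c ^ 2 * ‖s‖ ^ 2) :=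
    mul_nonneg (by positivity) hsq
  have g4 : 0 ≤ δ * α * β * μ * (c ^ 2 / 2 + c / 2) * ‖s‖ ^ 2 := by positivity
  have g5 : 0 ≤ (δ * γ - 1) * (c + 1 / 2) * ‖s‖ ^ 2 := by positivity
  have g6 : 0 ≤ δ * α * β * ε / 2 * (‖a‖ ^ 2 + c * ‖s‖ ^ 2) := by positivity
  have hcδ : δ ^ 2 * β = δ * α * β * c := by rw [sq]; nth_rw 2 [hcα]; ring
  rw [hcδ] at g2 ⊢
  linarith

/-- Residuals of a multiplier update stay controlled by any monotone bound on the multipliers. -/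
lemma residual_sub_multiplier_le {Z : Type*} [NormedAddCommGroup Z] [NormedSpace ℝ Z]
    {δ : ℝ} (hδ : 0 < δ) {α β M : ℕ → ℝ} {r l : ℕ → Z} {K : ℕ}
    (hα : ∀ k, K ≤ k → 0 < α k) (hβ : ∀ k, K ≤ k → 0 < β k)
    (hββ : ∀ k, K ≤ k → δ * β (k + 1) ≤ δ * β k + α k * β k)
    (hl : ∀ k, K ≤ k → l (k + 1) - l k
      = (δ * β k + α k * β k) • r (k + 1) - (δ * β k) • r k)
    (hM : ∀ k, K ≤ k → M k ≤ M (k + 1)) (hlM : ∀ k, K ≤ k → ‖l k‖ ≤ M k)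
    (hK : ‖(δ * β K) • r K - l K‖ ≤ M K) :
    ∀ k, K ≤ k → ‖(δ * β k) • r k - l k‖ ≤ M k := by
  intro k hk
  induction k, hk using Nat.le_induction with
  | base => exact hK
  | succ k hk ih =>
    set D := δ * β k + α k * β k with hD
    have hDpos : 0 < D := by have := hα k hk; have := hβ k hk; positivity
    set θ := δ * β (k + 1) / D with hθ
    have h0 : 0 ≤ θ := by have := hβ (k + 1) (by omega); positivity
    have h1 : θ ≤ 1 := (div_le_one hDpos).2 (hββ k hk)
    have e1 : δ * β (k + 1) = θ * D := by rw [hθ]; field_simp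
    have e2 : D • r (k + 1) = (δ * β k) • r k - l k + l (k + 1) := by
      have := hl k hk
      rw [sub_eq_sub_iff_add_eq_add] at this
      rw [sub_add_eq_add_sub, eq_sub_iff_add_eq, ← this]
      abel
    have e3 : (δ * β (k + 1)) • r (k + 1) - l (k + 1)
        = θ • ((δ * β k) • r k - l k) - (1 - θ) • l (k + 1) := by
      rw [e1, mul_smul, e2]
      module
    rw [e3]
    refine (norm_sub_le _ _).trans ?_
    rw [norm_smul, norm_smul, Real.norm_of_nonneg h0, Real.norm_of_nonneg (by linarith)]
    have a1 := mul_le_mul_of_nonneg_left (ih.trans (hM k hk)) h0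
    have a2 := mul_le_mul_of_nonneg_left (hlM (k + 1) (by omega)) (show 0 ≤ 1 - θ by linarith)
    linarith

/-- If the Lagrangian gap and the constraint residual vanish along `(x k, y k)`, whose norms are
asymptotically at most that of the minimal norm solution, then `(x k, y k)` converges strongly to
that solution. -/
lemma tendsto_prod_of_gap_of_residual {X Y Z : Type*}
    [NormedAddCommGroup X] [InnerProductSpace ℝ X] [CompleteSpace X]
    [NormedAddCommGroup Y] [InnerProductSpace ℝ Y] [CompleteSpace Y]
    [NormedAddCommGroup Z] [InnerProductSpace ℝ Z]
    {f : X → ℝ} {g : Y → ℝ}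
    (hfconv : ConvexOn ℝ Set.univ f) (hfcont : Continuous f)
    (hgconv : ConvexOn ℝ Set.univ g) (hgcont : Continuous g)
    (A : X →L[ℝ] Z) (B : Y →L[ℝ] Z) {b ls : Z} {xs : X} {ys : Y} (hfeas : A xs + B ys = b)
    (hls : ∀ x' y', 0 ≤ f x' + g y' + ⟪ls, A x' + B y' - b⟫ - (f xs + g ys))
    (hopt : ∀ x' y', A x' + B y' = b → f xs + g ys ≤ f x' + g y')
    (hmn : ∀ x' y', A x' + B y' = b →
        (∀ x'' y'', A x'' + B y'' = b → f x' + g y' ≤ f x'' + g y'') →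
        ‖xs‖ ^ 2 + ‖ys‖ ^ 2 ≤ ‖x'‖ ^ 2 + ‖y'‖ ^ 2)
    {x : ℕ → X} {y : ℕ → Y} {t : ℕ → ℝ}
    (hgap : Tendsto (fun k => f (x k) + g (y k) + ⟪ls, A (x k) + B (y k) - b⟫ - (f xs + g ys))
      atTop (𝓝 0))
    (hres : Tendsto (fun k => ‖A (x k) + B (y k) - b‖) atTop (𝓝 0))
    (ht : Tendsto t atTop (𝓝 0))
    (hnorm : ∀ᶠ k in atTop, ‖x k‖ ^ 2 + ‖y k‖ ^ 2 ≤ ‖xs‖ ^ 2 + ‖ys‖ ^ 2 + t k) :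
    Tendsto (fun k => Real.sqrt (‖x k - xs‖ ^ 2 + ‖y k - ys‖ ^ 2)) atTop (𝓝 0) := by
  obtain ⟨V, hV⟩ : ∃ V : WithLp 2 (X × Y) → ℝ, ∀ w, V w = f w.fst + g w.snd
      + ⟪ls, A w.fst + B w.snd - b⟫ - (f xs + g ys) + ‖A w.fst + B w.snd - b‖ := ⟨_, fun _ => rfl⟩
  have hVconv : ConvexOn ℝ Set.univ V := by
    refine ⟨convex_univ, fun a _ c _ s t hs ht hst => ?_⟩
    have h1 := hfconv.2 (Set.mem_univ a.fst) (Set.mem_univ c.fst) hs ht hst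
    have h2 := hgconv.2 (Set.mem_univ a.snd) (Set.mem_univ c.snd) hs ht hst
    have e : A (s • a + t • c).fst + B (s • a + t • c).snd - b
        = s • (A a.fst + B a.snd - b) + t • (A c.fst + B c.snd - b) := by
      have hb : b = s • b + t • b := by rw [← add_smul, hst, one_smul]
      simp only [WithLp.add_fst, WithLp.add_snd, WithLp.smul_fst, WithLp.smul_snd, map_add,
        map_smul]
      nth_rw 1 [hb]
      module
    have h3 := norm_add_le (s • (A a.fst + B a.snd - b)) (t • (A c.fst + B c.snd - b))
    rw [norm_smul, norm_smul, Real.norm_of_nonneg hs, Real.norm_of_nonneg ht] at h3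
    have h4 : f xs + g ys = s * (f xs + g ys) + t * (f xs + g ys) := by
      rw [← add_mul, hst, one_mul]
    rw [hV, hV, hV, e, inner_add_right, inner_smul_right, inner_smul_right]
    simp only [WithLp.add_fst, WithLp.add_snd, WithLp.smul_fst, WithLp.smul_snd, smul_eq_mul]
      at h1 h2 ⊢
    linarith
  have hVcont : Continuous V := by
    have h : V = fun w => f w.fst + g w.snd
      + ⟪ls, A w.fst + B w.snd - b⟫ - (f xs + g ys) + ‖A w.fst + B w.snd - b‖ := funext hV
    have h1 : Continuous fun w : WithLp 2 (X × Y) => w.fst :=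
      continuous_fst.comp (WithLp.prod_continuous_ofLp 2 X Y)
    have h2 : Continuous fun w : WithLp 2 (X × Y) => w.snd :=
      continuous_snd.comp (WithLp.prod_continuous_ofLp 2 X Y)
    rw [h]
    fun_prop
  have hlim := tendsto_of_convex_of_norm_le hVconv hVcont (p := WithLp.toLp 2 (xs, ys))
    (w := fun k => WithLp.toLp 2 (x k, y k)) (t := t) (by simp [hV, hfeas])
    (fun c hc => by
      rw [hV] at hc
      have h1 := hls c.fst c.snd
      have h2 : A c.fst + B c.snd - b = 0 :=
        norm_eq_zero.1 (le_antisymm (by linarith) (norm_nonneg _))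
      rw [h2, inner_zero_right, norm_zero] at hc
      have h3 := sub_eq_zero.1 h2
      rw [WithLp.prod_norm_sq_eq_of_L2, WithLp.prod_norm_sq_eq_of_L2]
      refine hmn _ _ h3 fun x' y' h' => ?_
      linarith [hopt x' y' h'])
    (by
      have h := hgap.add hres
      rw [add_zero] at h
      refine h.congr fun k => ?_
      rw [hV]
      rfl)
    ht
    (by
      filter_upwards [hnorm] with k hk
      rw [WithLp.prod_norm_sq_eq_of_L2, WithLp.prod_norm_sq_eq_of_L2]
      exact hk)
  refine (tendsto_iff_norm_sub_tendsto_zero.1 hlim).congr fun k => ?_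
  rw [WithLp.prod_norm_eq_of_L2]
  rfl

theorem strong_convergence_to_minimal_norm_solution_algorithm1
    {X Y Z : Type*}
    [NormedAddCommGroup X] [InnerProductSpace ℝ X] [CompleteSpace X]
    [NormedAddCommGroup Y] [InnerProductSpace ℝ Y] [CompleteSpace Y]
    [NormedAddCommGroup Z] [InnerProductSpace ℝ Z] [CompleteSpace Z]
    (f : X → ℝ) (g : Y → ℝ)
    (hfconv : ConvexOn ℝ Set.univ f) (hfcont : Continuous f)
    (hgconv : ConvexOn ℝ Set.univ g) (hgcont : Continuous g)
    (A : X →L[ℝ] Z) (B : Y →L[ℝ] Z) (b : Z)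
    (μf μg : ℝ) (hμf : 0 ≤ μf) (hμg : 0 ≤ μg)
    (hfS : ∀ x u v : X, (∀ w, f w - f x ≥ ⟪v, w - x⟫) →
        f u - f x - ⟪v, u - x⟫ ≥ μf / 2 * ‖u - x‖ ^ 2)
    (hgS : ∀ y u v : Y, (∀ w, g w - g y ≥ ⟪v, w - y⟫) →
        g u - g y - ⟪v, u - y⟫ ≥ μg / 2 * ‖u - y‖ ^ 2)
    (L : X → Y → Z → ℝ)
    (hL : ∀ x y l, L x y l = f x + g y + ⟪l, A x + B y - b⟫)
    (δ γ : ℝ) (hδ : 0 < δ) (hγ : 0 < γ)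
    (α β ε : ℕ → ℝ)
    (hα : ∀ k, 1 ≤ k → 0 < α k)
    (hβpos : ∀ k, 1 ≤ k → 0 < β k)
    (hβmono : ∀ k, 1 ≤ k → β k ≤ β (k + 1))
    (hεnn : ∀ k, 1 ≤ k → 0 ≤ ε k)
    (hβtop : Tendsto β atTop atTop)
    (x : ℕ → X) (y : ℕ → Y) (lam : ℕ → Z)
    (Zs Zd : ℕ → X) (Hs Hd : ℕ → Y)
    (hZ : ∀ k, 1 ≤ k → Zs (k + 1) = (1 / α k) • (x (k + 1) - x k) + γ • x (k + 1))
    (hZd : ∀ k, 1 ≤ k → Zd (k + 1) = δ • Zs (k + 1) + (1 - δ * γ) • x (k + 1))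
    (hH : ∀ k, 1 ≤ k → Hs (k + 1) = (1 / α k) • (y (k + 1) - y k) + γ • y (k + 1))
    (hHd : ∀ k, 1 ≤ k → Hd (k + 1) = δ • Hs (k + 1) + (1 - δ * γ) • y (k + 1))
    (hlam : ∀ k, 1 ≤ k → lam (k + 1) = lam k + (α k * β k) • (A (Zd (k + 1)) + B (Hd (k + 1)) - b))
    (hstep : ∀ k, 1 ≤ k → ∃ u v,
        (∀ w, f w - f (x (k + 1)) ≥ ⟪u, w - x (k + 1)⟫) ∧
        (∀ w, g w - g (y (k + 1)) ≥ ⟪v, w - y (k + 1)⟫) ∧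
        (1 / α k) • (Zs (k + 1) - Zs k) =
          -(β k • (u + (ContinuousLinearMap.adjoint A) (lam (k + 1)) + ε k • x (k + 1)
              - μf • (x (k + 1) - Zd (k + 1)))) ∧
        (1 / α k) • (Hs (k + 1) - Hs k) =
          -(β k • (v + (ContinuousLinearMap.adjoint B) (lam (k + 1)) + ε k • y (k + 1)
              - μg • (y (k + 1) - Hd (k + 1)))))
    (hδγ : δ * γ - 1 ≥ 0)
    (hββ : ∀ k, 1 ≤ k → δ * β (k + 1) ≤ δ * β k + α k * β k)
    (hεmono : ∀ k, 1 ≤ k → ε (k + 1) ≤ ε k)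
    (hsum : Summable (fun k => α k * ε k))
    (hβεtop : Tendsto (fun k => β k * ε k) atTop atTop)
    (xs : X) (ys : Y) (ls : Z)
    (hsaddle : ∀ x' y' l', L xs ys l' ≤ L xs ys ls ∧ L xs ys ls ≤ L x' y' ls)
    (hfeas : A xs + B ys = b)
    (hopt : ∀ x' y', A x' + B y' = b → f xs + g ys ≤ f x' + g y')
    (hmn : ∀ x' y', A x' + B y' = b →
        (∀ x'' y'', A x'' + B y'' = b → f x' + g y' ≤ f x'' + g y'') →
        ‖xs‖ ^ 2 + ‖ys‖ ^ 2 ≤ ‖x'‖ ^ 2 + ‖y'‖ ^ 2)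
    (hK : ∃ K : ℕ, 1 ≤ K ∧
        ((∀ k, K ≤ k → ‖xs‖ ^ 2 + ‖ys‖ ^ 2 ≤ ‖x k‖ ^ 2 + ‖y k‖ ^ 2) ∨
         (∀ k, K ≤ k → ‖x k‖ ^ 2 + ‖y k‖ ^ 2 < ‖xs‖ ^ 2 + ‖ys‖ ^ 2)))
    :
    Tendsto (fun k => Real.sqrt (‖x k - xs‖ ^ 2 + ‖y k - ys‖ ^ 2)) atTop (𝓝 0) := by
  have hls : ∀ x' y', 0 ≤ f x' + g y' + ⟪ls, A x' + B y' - b⟫ - (f xs + g ys) := fun x' y' => by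
    have h := (hsaddle x' y' ls).2
    rw [hL, hL, hfeas, sub_self, inner_zero_right] at h
    linarith
  obtain ⟨r, hr⟩ : ∃ r : ℕ → Z, ∀ k, r k = A (x k) + B (y k) - b := ⟨_, fun _ => rfl⟩
  obtain ⟨G, hG⟩ : ∃ G : ℕ → ℝ, ∀ k, G k = f (x k) + g (y k) + ⟪ls, r k⟫ - (f xs + g ys) :=
    ⟨_, fun _ => rfl⟩
  obtain ⟨N, hN⟩ : ∃ N : ℕ → ℝ, ∀ k, N k = ‖x k‖ ^ 2 + ‖y k‖ ^ 2 := ⟨_, fun _ => rfl⟩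
  obtain ⟨n₀, hn₀⟩ : ∃ n₀, n₀ = ‖xs‖ ^ 2 + ‖ys‖ ^ 2 := ⟨_, rfl⟩
  obtain ⟨Q, hQ⟩ : ∃ Q : ℕ → ℝ, ∀ k, Q k
      = (1 / 2 * ‖δ • Zs k + (1 - δ * γ) • x k - xs‖ ^ 2 + (δ * γ - 1) / 2 * ‖x k - xs‖ ^ 2)
      + (1 / 2 * ‖δ • Hs k + (1 - δ * γ) • y k - ys‖ ^ 2 + (δ * γ - 1) / 2 * ‖y k - ys‖ ^ 2)
      + δ / 2 * ‖lam k - ls‖ ^ 2 := ⟨_, fun _ => rfl⟩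
  have hδγ' : 0 ≤ δ * γ - 1 := hδγ
  have hG0 : ∀ k, 0 ≤ G k := fun k => by rw [hG, hr]; exact hls _ _
  have hN0 : ∀ k, 0 ≤ N k := fun k => by rw [hN]; positivity
  have hn₀0 : 0 ≤ n₀ := by rw [hn₀]; positivity
  have hQl : ∀ k, δ / 2 * ‖lam k - ls‖ ^ 2 ≤ Q k := fun k => by
    rw [hQ]
    have : 0 ≤ (1 / 2 * ‖δ • Zs k + (1 - δ * γ) • x k - xs‖ ^ 2
      + (δ * γ - 1) / 2 * ‖x k - xs‖ ^ 2)
      + (1 / 2 * ‖δ • Hs k + (1 - δ * γ) • y k - ys‖ ^ 2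
      + (δ * γ - 1) / 2 * ‖y k - ys‖ ^ 2) := by positivity
    linarith
  have hQ0 : ∀ k, 0 ≤ Q k := fun k => le_trans (by positivity) (hQl k)
  have hlr : ∀ k, 1 ≤ k → lam (k + 1) - lam k
      = (δ * β k + α k * β k) • r (k + 1) - (δ * β k) • r k := fun k hk => by
    have h0 := (hα k hk).ne'
    have e : α k * β k * (δ * (1 / α k)) = δ * β k := by field_simp
    have e1 : Zd (k + 1) = x (k + 1) + (δ * (1 / α k)) • (x (k + 1) - x k) := by
      rw [hZd k hk, hZ k hk]; module
    have e2 : Hd (k + 1) = y (k + 1) + (δ * (1 / α k)) • (y (k + 1) - y k) := by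
      rw [hHd k hk, hH k hk]; module
    rw [hlam k hk, hr, hr, e1, e2, ← e]
    simp only [map_add, map_sub, map_smul]
    module
  have hcore : ∀ k, 1 ≤ k → Q (k + 1) + δ * α k * β k * G (k + 1)
      + δ ^ 2 * β k * (G (k + 1) - G k) + δ * α k * β k * ε k / 2 * (N (k + 1) - n₀)
      + δ ^ 2 * β k * ε k / 2 * (N (k + 1) - N k) ≤ Q k := fun k hk => by
    obtain ⟨u, v, hu, hv, hsu, hsv⟩ := hstep k hk
    have hx := block_energy_step (p := xs) hμf hδ hδγ' (hα k hk) (hβpos k hk) (hεnn k hk)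
      (fun w => hfS _ w u hu) (hZ k hk) (hZd k hk) hsu
    have hy := block_energy_step (p := ys) hμg hδ hδγ' (hα k hk) (hβpos k hk) (hεnn k hk)
      (fun w => hgS _ w v hv) (hH k hk) (hHd k hk) hsv
    rw [ContinuousLinearMap.adjoint_inner_left, map_sub] at hx hy
    have hab : (α k * β k) * (⟪lam (k + 1), A (Zd (k + 1)) - A xs⟫
        + ⟪lam (k + 1), B (Hd (k + 1)) - B ys⟫)
        = ⟪lam (k + 1) - ls, lam (k + 1) - lam k⟫ + ⟪ls, lam (k + 1) - lam k⟫ := by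
      rw [← inner_add_right, ← inner_add_left, sub_add_cancel, ← inner_smul_right, hlam k hk,
        add_sub_cancel_left, ← hfeas]
      congr 2
      abel
    have hsq : 1 / 2 * ‖lam (k + 1) - ls‖ ^ 2 - 1 / 2 * ‖lam k - ls‖ ^ 2
        ≤ ⟪lam (k + 1) - ls, lam (k + 1) - lam k⟫ := by
      have h1 := norm_sub_sq_real (lam (k + 1) - ls) (lam (k + 1) - lam k)
      rw [sub_sub_sub_cancel_left] at h1
      nlinarith [sq_nonneg ‖lam (k + 1) - lam k‖]
    have hlsr : ⟪ls, lam (k + 1) - lam k⟫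
        = (δ * β k + α k * β k) * ⟪ls, r (k + 1)⟫ - δ * β k * ⟪ls, r k⟫ := by
      rw [hlr k hk, inner_sub_right, inner_smul_right, inner_smul_right]
    rw [hQ, hQ, hG, hG, hN, hN, hn₀, ← hZd k hk, ← hHd k hk]
    rw [hlsr] at hab
    have hab' := congrArg (δ * ·) hab
    have hsq' := mul_le_mul_of_nonneg_left hsq hδ.le
    linarith
  have hβδ : ∀ k, 1 ≤ k → δ ^ 2 * β (k + 1) ≤ δ ^ 2 * β k + δ * α k * β k := fun k hk => by
    have := mul_le_mul_of_nonneg_left (hββ k hk) hδ.le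
    linarith
  have hdecr : ∀ k, 1 ≤ k → ∀ h, 0 ≤ h → δ ^ 2 * β (k + 1) * (G (k + 1) + ε (k + 1) / 2 * h)
      ≤ (δ ^ 2 * β k + δ * α k * β k) * (G (k + 1) + ε k / 2 * h) := fun k hk h h0 => by
    have h1 := hβpos (k + 1) (by omega)
    have h2 := hεnn (k + 1) (by omega)
    have h3 := hεmono k hk
    have h4 := hG0 (k + 1)
    refine mul_le_mul (hβδ k hk) (by gcongr) (by positivity) ?_
    exact le_trans (by positivity) (hβδ k hk)
  -- the energy is negligible compared with `β`
  obtain ⟨E, hE⟩ : ∃ E : ℕ → ℝ, ∀ k, E k = δ ^ 2 * β k * (G k + ε k / 2 * N k) + Q k :=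
    ⟨_, fun _ => rfl⟩
  have hEG : ∀ k, 1 ≤ k → δ ^ 2 * β k * G k ≤ E k := fun k hk => by
    have h1 := hβpos k hk
    have h2 := hεnn k hk
    have h3 := hN0 k
    have h4 : 0 ≤ δ ^ 2 * β k * (ε k / 2 * N k) := by positivity
    rw [hE]
    linarith [hQ0 k]
  have hE0 : ∀ k, 1 ≤ k → 0 ≤ E k := fun k hk => by
    have h1 := hβpos k hk
    have h2 := hG0 k
    exact le_trans (by positivity) (hEG k hk)
  have hElam : ∀ k, 1 ≤ k → δ / 2 * ‖lam k - ls‖ ^ 2 ≤ E k := fun k hk => by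
    have h1 := hβpos k hk
    have h2 := hεnn k hk
    have h3 := hN0 k
    have h4 := hG0 k
    have h5 : 0 ≤ δ ^ 2 * β k * (G k + ε k / 2 * N k) := by positivity
    rw [hE]
    linarith [hQl k]
  have hEβ : Tendsto (fun k => E k / β k) atTop (𝓝 0) := by
    refine tendsto_div_of_le_add_mul_summable hE0 hβpos hβmono hβtop
      (s := fun k => δ * n₀ / 2 * (α k * ε k)) ?_ (hsum.mul_left _) ?_
    · intro k hk
      have h1 := hα k hk
      have h2 := hεnn k hk
      positivity
    · intro k hk
      have h1 := hcore k hk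
      have h2 := hdecr k hk _ (hN0 (k + 1))
      rw [hE, hE]
      linarith
  have hGlim : Tendsto G atTop (𝓝 0) := by
    have h := hEβ.div_const (δ ^ 2)
    rw [zero_div] at h
    refine squeeze_zero' (Eventually.of_forall hG0) ?_ h
    filter_upwards [eventually_ge_atTop 1] with k hk
    have h1 := hβpos k hk
    rw [div_div, le_div_iff₀ (by positivity)]
    linarith [hEG k hk]
  -- the iterates are asymptotically feasible
  have hrlim : Tendsto (fun k => ‖r k‖) atTop (𝓝 0) := by
    obtain ⟨K, hK⟩ := eventually_atTop.1
      ((hEβ.eventually (gt_mem_nhds one_pos)).and (eventually_ge_atTop 1))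
    have hK1 : 1 ≤ K := (hK K le_rfl).2
    obtain ⟨c, hc⟩ : ∃ c, c = ‖ls‖ + ‖(δ * β K) • r K - lam K‖ := ⟨_, rfl⟩
    obtain ⟨M, hM⟩ : ∃ M : ℕ → ℝ, ∀ k, M k = c + √(2 / δ) * √(β k) := ⟨_, fun _ => rfl⟩
    have hlM : ∀ k, K ≤ k → ‖lam k‖ ≤ M k := fun k hk => by
      have hk1 : 1 ≤ k := hK1.trans hk
      have h1 := (hK k hk).1
      rw [div_lt_one (hβpos k hk1)] at h1
      have h2 : ‖lam k - ls‖ ≤ √(2 / δ) * √(β k) := by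
        rw [← Real.sqrt_mul (by positivity)]
        refine Real.le_sqrt_of_sq_le ?_
        have h3 := (hElam k hk1).trans h1.le
        have h4 : 2 / δ * (δ / 2 * ‖lam k - ls‖ ^ 2) = ‖lam k - ls‖ ^ 2 := by field_simp
        rw [← h4]
        gcongr
      have h5 : ‖lam k‖ ≤ ‖lam k - ls‖ + ‖ls‖ := by
        simpa using norm_add_le (lam k - ls) ls
      rw [hM, hc]
      linarith [norm_nonneg ((δ * β K) • r K - lam K)]
    have hres := residual_sub_multiplier_le hδ (fun k hk => hα k (hK1.trans hk))
      (fun k hk => hβpos k (hK1.trans hk)) (fun k hk => hββ k (hK1.trans hk))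
      (fun k hk => hlr k (hK1.trans hk)) (M := M)
      (fun k hk => by
        rw [hM, hM]
        have := Real.sqrt_le_sqrt (hβmono k (hK1.trans hk))
        gcongr) hlM
      (by rw [hM, hc]; nlinarith [norm_nonneg ls, Real.sqrt_nonneg (2 / δ), Real.sqrt_nonneg (β K)])
    have hb : Tendsto (fun k => (2 * c / δ) / β k + (2 * √(2 / δ) / δ) / √(β k)) atTop (𝓝 0) := by
      have h1 := (tendsto_const_nhds (x := 2 * c / δ)).div_atTop hβtop
      have h2 := (tendsto_const_nhds (x := 2 * √(2 / δ) / δ)).div_atTop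
        (Real.tendsto_sqrt_atTop.comp hβtop)
      simpa using h1.add h2
    refine squeeze_zero' (Eventually.of_forall fun k => norm_nonneg _) ?_ hb
    filter_upwards [eventually_ge_atTop K] with k hk
    have h1 := hβpos k (hK1.trans hk)
    have h2 : ‖(δ * β k) • r k‖ ≤ 2 * M k := by
      have h3 := norm_add_le ((δ * β k) • r k - lam k) (lam k)
      rw [sub_add_cancel] at h3
      linarith [hres k hk, hlM k hk]
    rw [norm_smul, Real.norm_of_nonneg (by positivity), hM] at h2
    have h4 : (2 * c / δ) / β k + (2 * √(2 / δ) / δ) / √(β k)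
        = 2 * (c + √(2 / δ) * √(β k)) / (δ * β k) := by
      have h5 : 0 < √(β k) := Real.sqrt_pos.2 h1
      have h6 : β k = √(β k) * √(β k) := (Real.mul_self_sqrt h1.le).symm
      have h7 : (2 * √(2 / δ) / δ) / √(β k) = 2 * √(2 / δ) / δ * √(β k) / β k := by
        nth_rw 3 [h6]
        field_simp
      rw [h7]
      field_simp
    rw [h4, le_div_iff₀ (by positivity)]
    linarith
  -- the norms are asymptotically at most the minimal norm
  have hnorm : ∃ t : ℕ → ℝ, Tendsto t atTop (𝓝 0) ∧ ∀ᶠ k in atTop, N k ≤ n₀ + t k := by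
    obtain ⟨K, hK1, hge | hlt⟩ := hK
    · obtain ⟨F, hF⟩ : ∃ F : ℕ → ℝ, ∀ k, F k
          = δ ^ 2 * β k * (G k + ε k / 2 * (N k - n₀)) + Q k := ⟨_, fun _ => rfl⟩
      have hNn : ∀ k, K ≤ k → 0 ≤ N k - n₀ := fun k hk => by
        rw [hN, hn₀]; linarith [hge k hk]
      have hFK : ∀ k, K ≤ k → F k ≤ F K := by
        intro k hk
        induction k, hk using Nat.le_induction with
        | base => exact le_rfl
        | succ k hk ih =>
          have hk1 := hK1.trans hk
          refine le_trans ?_ ih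
          have h1 := hcore k hk1
          have h2 := hdecr k hk1 _ (hNn (k + 1) (by omega))
          rw [hF, hF]
          linarith
      refine ⟨fun k => (2 * F K / δ ^ 2) / (β k * ε k), tendsto_const_nhds.div_atTop hβεtop, ?_⟩
      filter_upwards [eventually_ge_atTop K, hβεtop.eventually_gt_atTop 0] with k hk hpos
      have h1 := hFK k hk
      rw [hF] at h1
      have h2 := hβpos k (hK1.trans hk)
      have h3 : 0 ≤ δ ^ 2 * β k * G k := by have := hG0 k; positivity
      rw [← sub_le_iff_le_add', le_div_iff₀ hpos, le_div_iff₀ (by positivity)]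
      linarith [hQ0 k]
    · refine ⟨fun _ => 0, tendsto_const_nhds, ?_⟩
      filter_upwards [eventually_ge_atTop K] with k hk
      rw [hN, hn₀]
      linarith [hlt k hk]
  obtain ⟨t, ht, htN⟩ := hnorm
  refine tendsto_prod_of_gap_of_residual hfconv hfcont hgconv hgcont A B hfeas hls hopt hmn
    (hGlim.congr fun k => ?_) (hrlim.congr fun k => ?_) ht ?_
  · rw [hG, hr]
  · rw [hr]
  · filter_upwards [htN] with k hk
    rwa [hN, hn₀] at hk
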